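/- arXiv:2001.00651 — 9 statements merged into one kernel-verified Lean document; each statement's English description precedes it below -/
import Mathlib

section
/- Suppose Q ∈ ℝ^{n×n} is symmetric positive definite with QA + AᵀQ + CᵀC ≤ 0. Then there exists α₀ > 0 such that for every α ≥ α₀ for which A_o := αI + A is invertible, the matrix S := A_o^{−ᵀ}Q satisfies S + Sᵀ ≥ 0 and the triple (Q, S, α) satisfies the extended observability LMI. (Paper Theorem 1, 'if' direction.) -/
open Matrix

noncomputable section

/-- The extended observability LMI: the block matrix
`[[X_o, Q − A_oᵀS], [Q − SᵀA_o, S + Sᵀ]]` is positive semidefinite, where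
`A_o = αI + A` and `X_o = −QA − AᵀQ − CᵀC`. -/
def extObsLMI {ι : Type*} [Fintype ι] [DecidableEq ι] {q : ℕ}
    (A : Matrix ι ι ℝ) (C : Matrix (Fin q) ι ℝ)
    (Q S : Matrix ι ι ℝ) (α : ℝ) : Prop :=
  (Matrix.fromBlocks
    (-(Q * A) - Aᵀ * Q - Cᵀ * C)
    (Q - (α • (1 : Matrix ι ι ℝ) + A)ᵀ * S)
    (Q - Sᵀ * (α • (1 : Matrix ι ι ℝ) + A))
    (S + Sᵀ)).PosSemidef

/-- A real symmetric matrix becomes positive semidefinite after adding any multiple of the identity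
that is at least the sum of the absolute values of its entries. -/
theorem Matrix.IsHermitian.posSemidef_smul_one_add {ι : Type*} [Fintype ι] [DecidableEq ι]
    {H : Matrix ι ι ℝ} (hH : H.IsHermitian) {c : ℝ} (hc : ∑ i, ∑ j, |H i j| ≤ c) :
    (c • (1 : Matrix ι ι ℝ) + H).PosSemidef := by
  refine .of_dotProduct_mulVec_nonneg ((isHermitian_one.smul (.all c)).add hH) fun x ↦ ?_
  have hx (i : ι) : x i ^ 2 ≤ x ⬝ᵥ x := by
    rw [pow_two]
    exact Finset.single_le_sum (f := fun k ↦ x k * x k) (fun k _ ↦ mul_self_nonneg _)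
      (Finset.mem_univ i)
  have hx0 : 0 ≤ x ⬝ᵥ x := Finset.sum_nonneg fun k _ ↦ mul_self_nonneg _
  have hij (i j : ι) : -(|H i j| * (x ⬝ᵥ x)) ≤ x i * (H i j * x j) := by
    have h : |x i * x j| ≤ x ⬝ᵥ x :=
      abs_le.2 ⟨by nlinarith [hx i, hx j, sq_nonneg (x i + x j)],
        by nlinarith [hx i, hx j, sq_nonneg (x i - x j)]⟩
    calc -(|H i j| * (x ⬝ᵥ x)) ≤ -(|H i j| * |x i * x j|) := by gcongr
      _ = -|H i j * (x i * x j)| := by rw [abs_mul (H i j)]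
      _ ≤ H i j * (x i * x j) := neg_abs_le _
      _ = x i * (H i j * x j) := by ring
  have hsum : -((∑ i, ∑ j, |H i j|) * (x ⬝ᵥ x)) ≤ x ⬝ᵥ (H *ᵥ x) := by
    simp only [Finset.sum_mul, ← Finset.sum_neg_distrib]
    rw [dotProduct]
    refine Finset.sum_le_sum fun i _ ↦ ?_
    rw [mulVec, dotProduct, Finset.mul_sum]
    exact Finset.sum_le_sum fun j _ ↦ hij i j
  rw [star_trivial, add_mulVec, dotProduct_add, smul_mulVec, one_mulVec, dotProduct_smul,
    smul_eq_mul]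
  nlinarith [mul_le_mul_of_nonneg_right hc hx0]

open scoped MatrixOrder Matrix.Norms.L2Operator in
/-- A positive definite real matrix factors as `Bᵀ B` with `B` invertible. -/
theorem Matrix.PosDef.exists_isUnit_eq_transpose_mul_self {ι : Type*} [Fintype ι] [DecidableEq ι]
    {Q : Matrix ι ι ℝ} (hQ : Q.PosDef) : ∃ B : Matrix ι ι ℝ, IsUnit B ∧ Q = Bᵀ * B := by
  obtain ⟨B, hB⟩ := CStarAlgebra.nonneg_iff_eq_star_mul_self.mp hQ.posSemidef.nonneg
  rw [star_eq_conjTranspose, conjTranspose_eq_transpose_of_trivial] at hB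
  exact ⟨B, isUnit_of_mul_isUnit_right (hB ▸ hQ.isUnit), hB⟩

/-- Large multiples of a positive definite matrix dominate any given symmetric matrix. -/
theorem Matrix.PosDef.exists_forall_posSemidef_smul_add {ι : Type*} [Fintype ι] [DecidableEq ι]
    {Q H : Matrix ι ι ℝ} (hQ : Q.PosDef) (hH : H.IsHermitian) :
    ∃ c : ℝ, 0 < c ∧ ∀ α : ℝ, c ≤ α → (α • Q + H).PosSemidef := by
  obtain ⟨B, hB, rfl⟩ := hQ.exists_isUnit_eq_transpose_mul_self
  have hdet : IsUnit B.det := (isUnit_iff_isUnit_det B).1 hB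
  have hK : (B⁻¹ᵀ * H * B⁻¹).IsHermitian := by
    simpa using isHermitian_conjTranspose_mul_mul B⁻¹ hH
  refine ⟨max 1 (∑ i, ∑ j, |(B⁻¹ᵀ * H * B⁻¹) i j|), by positivity, fun α hα ↦ ?_⟩
  have h := (hK.posSemidef_smul_one_add ((le_max_right _ _).trans hα)).conjTranspose_mul_mul_same B
  have e : Bᵀ * (B⁻¹ᵀ * H * B⁻¹) * B = H := by
    rw [← Matrix.mul_assoc, ← Matrix.mul_assoc, ← transpose_mul, nonsing_inv_mul B hdet,
      transpose_one, Matrix.one_mul, Matrix.mul_assoc, nonsing_inv_mul B hdet, Matrix.mul_one]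
  rwa [conjTranspose_eq_transpose_of_trivial, Matrix.mul_add, Matrix.add_mul, e, Matrix.mul_smul,
    Matrix.smul_mul, Matrix.mul_one] at h

/-- A block diagonal matrix with positive semidefinite diagonal blocks is positive semidefinite. -/
theorem Matrix.PosSemidef.fromBlocks_zero {ι κ : Type*} [Fintype ι] [Fintype κ]
    {M : Matrix ι ι ℝ} {N : Matrix κ κ ℝ} (hM : M.PosSemidef) (hN : N.PosSemidef) :
    (fromBlocks M 0 0 N).PosSemidef := by
  refine .of_dotProduct_mulVec_nonneg (hM.isHermitian.fromBlocks (by simp) hN.isHermitian)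
    fun x ↦ ?_
  rw [← Sum.elim_comp_inl_inr (star x), fromBlocks_mulVec, sumElim_dotProduct_sumElim]
  simpa using add_nonneg (hM.dotProduct_mulVec_nonneg (x ∘ Sum.inl))
    (hN.dotProduct_mulVec_nonneg (x ∘ Sum.inr))

/-- if symmetric positive definite `Q` satisfies `QA + AᵀQ + CᵀC ≤ 0`, then
there is `α₀ > 0` such that for every `α ≥ α₀` with `A_o = αI + A` invertible, the matrix
`S = A_o⁻ᵀ Q` satisfies `S + Sᵀ ≥ 0` and `(Q, S, α)` satisfies the extended
observability LMI. -/
theorem genObsGramian_implies_extObsLMI {n m q : ℕ}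
    (A : Matrix (Fin n) (Fin n) ℝ) (B : Matrix (Fin n) (Fin m) ℝ)
    (C : Matrix (Fin q) (Fin n) ℝ)
    (Q : Matrix (Fin n) (Fin n) ℝ)
    (hQ : Q.PosDef)
    (hLyap : (-(Q * A + Aᵀ * Q + Cᵀ * C)).PosSemidef) :
    ∃ α₀ : ℝ, 0 < α₀ ∧ ∀ α : ℝ, α₀ ≤ α →
      IsUnit (α • (1 : Matrix (Fin n) (Fin n) ℝ) + A) →
      ((((α • (1 : Matrix (Fin n) (Fin n) ℝ) + A)⁻¹)ᵀ * Q)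
        + (((α • (1 : Matrix (Fin n) (Fin n) ℝ) + A)⁻¹)ᵀ * Q)ᵀ).PosSemidef ∧
      extObsLMI A C Q (((α • (1 : Matrix (Fin n) (Fin n) ℝ) + A)⁻¹)ᵀ * Q) α := by
  have hQt : Qᵀ = Q := by
    rw [← conjTranspose_eq_transpose_of_trivial]
    exact hQ.isHermitian
  have hH : (Q * A + Aᵀ * Q).IsHermitian := by
    rw [IsHermitian, conjTranspose_eq_transpose_of_trivial]
    simp [hQt, add_comm]
  obtain ⟨c, hc, h⟩ := hQ.exists_forall_posSemidef_smul_add hH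
  refine ⟨c, hc, fun α hα hu ↦ ?_⟩
  have hdom : ((α + α) • Q + (Q * A + Aᵀ * Q)).PosSemidef := h _ (by linarith)
  have hsum : (α + α) • Q + (Q * A + Aᵀ * Q) =
      Q * (α • (1 : Matrix (Fin n) (Fin n) ℝ) + A)
        + (α • (1 : Matrix (Fin n) (Fin n) ℝ) + A)ᵀ * Q := by
    simp only [Matrix.mul_add, Matrix.add_mul, transpose_add, transpose_smul, transpose_one,
      Matrix.mul_smul, Matrix.smul_mul, Matrix.mul_one, Matrix.one_mul, add_smul]
    abel
  rw [hsum] at hdom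
  unfold extObsLMI
  set F := α • (1 : Matrix (Fin n) (Fin n) ℝ) + A with hF
  have hdet : IsUnit F.det := (isUnit_iff_isUnit_det F).1 hu
  have hFt : F⁻¹ᵀ * Fᵀ = 1 := by rw [← transpose_mul, mul_nonsing_inv F hdet, transpose_one]
  have hFt' : Fᵀ * F⁻¹ᵀ = 1 := by rw [← transpose_mul, nonsing_inv_mul F hdet, transpose_one]
  have hS : (F⁻¹ᵀ * Q + (F⁻¹ᵀ * Q)ᵀ).PosSemidef := by
    convert hdom.conjTranspose_mul_mul_same F⁻¹ using 1
    rw [conjTranspose_eq_transpose_of_trivial, transpose_mul, transpose_transpose, hQt,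
      Matrix.mul_add, Matrix.add_mul, ← Matrix.mul_assoc F⁻¹ᵀ Fᵀ, hFt, Matrix.one_mul,
      ← Matrix.mul_assoc, Matrix.mul_assoc _ F, mul_nonsing_inv F hdet, Matrix.mul_one]
  refine ⟨hS, ?_⟩
  have h12 : Q - Fᵀ * (F⁻¹ᵀ * Q) = 0 := by
    rw [← Matrix.mul_assoc, hFt', Matrix.one_mul, sub_self]
  have h21 : Q - (F⁻¹ᵀ * Q)ᵀ * F = 0 := by
    rw [transpose_mul, transpose_transpose, hQt, Matrix.mul_assoc, nonsing_inv_mul F hdet,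
      Matrix.mul_one, sub_self]
  have h11 : -(Q * A) - Aᵀ * Q - Cᵀ * C = -(Q * A + Aᵀ * Q + Cᵀ * C) := by abel
  rw [h12, h21, h11]
  exact hLyap.fromBlocks_zero hS
end
end

section
/- Let Q ∈ ℝ^{n×n} be symmetric positive definite with X_o := −QA − AᵀQ − CᵀC positive definite, let α > 0, and let Γ_o ∈ ℝ^{n×n} be symmetric with αQ + Γ_o positive definite. Set S := Q(αQ + Γ_o)^{−1}Q. Then S is symmetric positive definite, and the triple (Q, S, α) satisfies the extended observability LMI if and only if 2αQ + 2Γ_o − (Γ_o − QA)X_o^{−1}(Γ_o − AᵀQ) ≥ 0. (Intermediate equivalence in the proof of Theorem 1, symmetric-S part.) -/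
open Matrix

noncomputable section

/-- with `Q` symmetric positive definite, `X_o = −QA − AᵀQ − CᵀC` positive
definite, `α > 0`, `Γ_o` symmetric with `αQ + Γ_o` positive definite and
`S = Q(αQ + Γ_o)⁻¹Q`, the matrix `S` is symmetric positive definite and `(Q, S, α)`
satisfies the extended observability LMI iff
`2αQ + 2Γ_o − (Γ_o − QA) X_o⁻¹ (Γ_o − AᵀQ) ≥ 0`. -/
theorem extObsLMI_symmS_iff {n m q : ℕ}
    (A : Matrix (Fin n) (Fin n) ℝ) (B : Matrix (Fin n) (Fin m) ℝ)
    (C : Matrix (Fin q) (Fin n) ℝ)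
    (Q Γo : Matrix (Fin n) (Fin n) ℝ) (α : ℝ)
    (hQ : Q.PosDef)
    (hXo : (-(Q * A) - Aᵀ * Q - Cᵀ * C).PosDef)
    (hα : 0 < α)
    (hΓ : Γoᵀ = Γo)
    (hpos : (α • Q + Γo).PosDef) :
    (Q * (α • Q + Γo)⁻¹ * Q).PosDef ∧
    (extObsLMI A C Q (Q * (α • Q + Γo)⁻¹ * Q) α ↔
      ((2 * α) • Q + (2 : ℝ) • Γo
        - (Γo - Q * A) * (-(Q * A) - Aᵀ * Q - Cᵀ * C)⁻¹ * (Γo - Aᵀ * Q)).PosSemidef) := by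
  have hQt : Qᵀ = Q := by simpa using hQ.isHermitian.eq
  have hQu : IsUnit Q.det := (isUnit_iff_isUnit_det Q).1 hQ.isUnit
  set V := α • Q + Γo with hV
  have hVt : Vᵀ = V := by simpa using hpos.isHermitian.eq
  have hVu : IsUnit V.det := (isUnit_iff_isUnit_det V).1 hpos.isUnit
  set S := Q * V⁻¹ * Q with hS
  have hSpos : S.PosDef := by
    have h := (hQ.isUnit.posDef_star_left_conjugate_iff (x := V⁻¹)).2 hpos.inv
    simpa [star_eq_conjTranspose, hQt, hS] using h
  refine ⟨hSpos, ?_⟩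
  have hSt : Sᵀ = S := by simpa using hSpos.isHermitian.eq
  set X := -(Q * A) - Aᵀ * Q - Cᵀ * C with hX
  set U := Q⁻¹ * V with hU
  have hUu : IsUnit U :=
    (isUnit_iff_isUnit_det U).2 <| by
      rw [hU, det_mul]
      exact ((isUnit_nonsing_inv_det_iff).2 hQu).mul hVu
  have hQU : Q * U = V := mul_nonsing_inv_cancel_left Q V hQu
  have hSU : S * U = Q := by
    rw [hS, Matrix.mul_assoc, hQU, Matrix.mul_assoc, nonsing_inv_mul V hVu, Matrix.mul_one]
  set M := Q - (α • (1 : Matrix (Fin n) (Fin n) ℝ) + A)ᵀ * S with hM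
  have hMU : M * U = Γo - Aᵀ * Q := by
    rw [hM, Matrix.sub_mul, hQU, Matrix.mul_assoc, hSU, hV]
    simp [Matrix.add_mul]
  have hUM : Uᵀ * Mᵀ = Γo - Q * A := by
    rw [← transpose_mul, hMU]
    simp [hΓ, hQt]
  have hMt : Q - Sᵀ * (α • (1 : Matrix (Fin n) (Fin n) ℝ) + A) = Mᴴ := by
    simp [hM, hQt, Matrix.transpose_mul]
  have hUSU : Uᵀ * (S + Sᵀ) * U = (2 * α) • Q + (2 : ℝ) • Γo := by
    have hUQ : Uᵀ * Q = V := by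
      simpa only [transpose_mul, hQt, hVt] using congrArg transpose hQU
    rw [hSt, Matrix.mul_assoc, Matrix.add_mul, hSU, Matrix.mul_add, hUQ, hV]
    module
  have hconj : Uᵀ * (S + Sᵀ - Mᴴ * X⁻¹ * M) * U
      = (2 * α) • Q + (2 : ℝ) • Γo - (Γo - Q * A) * X⁻¹ * (Γo - Aᵀ * Q) := by
    rw [Matrix.mul_sub, Matrix.sub_mul, hUSU, ← hUM, ← hMU]
    simp [Matrix.mul_assoc]
  have : Invertible X := hXo.isUnit.invertible
  rw [← hconj, extObsLMI, ← hX, ← hM, hMt, hXo.fromBlocks₁₁,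
    ← hUu.posSemidef_star_left_conjugate_iff]
  simp [star_eq_conjTranspose]
end
end

section
/- Let Q ∈ ℝ^{n×n} be symmetric positive definite with X_o := −QA − AᵀQ − CᵀC positive definite, and let Γ_o ∈ ℝ^{n×n} be symmetric. Then there exists α₀ > 0 such that for every α ≥ α₀ the matrix αQ + Γ_o is positive definite, S := Q(αQ + Γ_o)^{−1}Q is symmetric positive definite, and the triple (Q, S, α) satisfies the extended observability LMI. (Paper Theorem 1, existence of a symmetric positive definite S.) -/
open Matrix

noncomputable section

/-- A symmetric perturbation of a positive definite matrix is positive definite as soon as the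
positive definite part is scaled by a large enough factor. -/
theorem Matrix.PosDef.exists_forall_smul_add_posDef {ι : Type*} [Fintype ι]
    {Q H : Matrix ι ι ℝ} (hQ : Q.PosDef) (hH : H.IsHermitian) :
    ∃ α₀ : ℝ, 0 < α₀ ∧ ∀ α : ℝ, α₀ ≤ α → (α • Q + H).PosDef := by
  have hpos : ∀ x : ι → ℝ, x ≠ 0 → 0 < x ⬝ᵥ (Q *ᵥ x) := fun x hx => by
    simpa using hQ.dotProduct_mulVec_pos hx
  have hcont : ContinuousOn (fun x : ι → ℝ => (x ⬝ᵥ (H *ᵥ x)) / (x ⬝ᵥ (Q *ᵥ x)))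
      (Metric.sphere 0 1) := by
    refine ContinuousOn.div (by fun_prop) (by fun_prop) fun x hx => (hpos x ?_).ne'
    exact ne_zero_of_mem_unit_sphere ⟨x, hx⟩
  obtain ⟨c, hc⟩ := ((isCompact_sphere (0 : ι → ℝ) 1).image_of_continuousOn hcont).bddBelow
  refine ⟨max 1 (1 - c), by positivity, fun α hα => ?_⟩
  have hα' : 1 - c ≤ α := (le_max_right _ _).trans hα
  refine .of_dotProduct_mulVec_pos ((hQ.isHermitian.smul (.all α)).add hH) fun x hx => ?_
  have hnorm : 0 < ‖x‖ := norm_pos_iff.2 hx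
  have hle : c ≤ (x ⬝ᵥ (H *ᵥ x)) / (x ⬝ᵥ (Q *ᵥ x)) := by
    have hmem : ‖x‖⁻¹ • x ∈ Metric.sphere (0 : ι → ℝ) 1 := by
      simp [norm_smul, hnorm.ne']
    have h := hc (Set.mem_image_of_mem _ hmem)
    simp only [mulVec_smul, dotProduct_smul, smul_dotProduct, smul_eq_mul] at h
    rwa [mul_div_mul_left _ _ (inv_ne_zero hnorm.ne'),
      mul_div_mul_left _ _ (inv_ne_zero hnorm.ne')] at h
  have hq := hpos x hx
  rw [le_div_iff₀ hq] at hle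
  simp only [star_trivial, add_mulVec, smul_mulVec, dotProduct_add, dotProduct_smul, smul_eq_mul]
  nlinarith

/-- With `S = Q(αQ + Γ)⁻¹Q`, the matrix of the extended observability LMI is congruent to
`[[X_o, Γ − AᵀQ], [Γ − QA, 2(αQ + Γ)]]`. -/
theorem extObsLMI_of_posSemidef {ι : Type*} [Fintype ι] [DecidableEq ι] {q : ℕ}
    {A : Matrix ι ι ℝ} {C : Matrix (Fin q) ι ℝ} {Q Γ : Matrix ι ι ℝ} {α : ℝ}
    (hQ : Qᵀ = Q) (hΓ : Γᵀ = Γ) (hM : IsUnit (α • Q + Γ))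
    (h : (fromBlocks (-(Q * A) - Aᵀ * Q - Cᵀ * C) (Γ - Aᵀ * Q) (Γ - Q * A)
      ((2 : ℝ) • (α • Q + Γ))).PosSemidef) :
    extObsLMI A C Q (Q * (α • Q + Γ)⁻¹ * Q) α := by
  have hMt : (α • Q + Γ)ᵀ = α • Q + Γ := by simp [hQ, hΓ]
  have hdet := (isUnit_iff_isUnit_det _).1 hM
  obtain ⟨M, hMdef⟩ : ∃ M, M = α • Q + Γ := ⟨_, rfl⟩
  rw [← hMdef] at h hMt hdet ⊢
  have hΓM : Γ = M - α • Q := by rw [hMdef]; abel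
  have hP := h.conjTranspose_mul_mul_same
    (fromBlocks (1 : Matrix ι ι ℝ) 0 0 (M⁻¹ * Q))
  have hSt : (Q * M⁻¹ * Q)ᵀ = Q * M⁻¹ * Q := by
    simp [transpose_nonsing_inv, hQ, hMt, Matrix.mul_assoc]
  have hPt : (M⁻¹ * Q)ᵀ = Q * M⁻¹ := by simp [transpose_nonsing_inv, hQ, hMt]
  unfold extObsLMI
  rw [hSt]
  convert hP using 1
  simp only [fromBlocks_transpose, conjTranspose_eq_transpose_of_trivial, hPt,
    fromBlocks_multiply, transpose_one, transpose_zero, Matrix.one_mul, Matrix.mul_one,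
    Matrix.zero_mul, Matrix.mul_zero, add_zero, zero_add]
  congr 1
  · rw [hΓM, sub_mul, sub_mul, mul_nonsing_inv_cancel_left _ _ hdet]
    simp only [transpose_add, transpose_smul, transpose_one, add_mul, smul_mul_assoc,
      Matrix.one_mul, Matrix.mul_assoc]
    abel
  · rw [hΓM, mul_sub, mul_sub, nonsing_inv_mul_cancel_right _ _ hdet]
    simp only [mul_add, mul_smul_comm, Matrix.mul_one, Matrix.mul_assoc]
    abel
  · rw [mul_smul_comm, nonsing_inv_mul_cancel_right _ _ hdet, smul_mul_assoc, two_smul,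
      Matrix.mul_assoc]

/-- with `Q` symmetric positive definite, `X_o = −QA − AᵀQ − CᵀC` positive
definite and `Γ_o` symmetric, there is `α₀ > 0` such that for every `α ≥ α₀` the matrix
`αQ + Γ_o` is positive definite, `S = Q(αQ + Γ_o)⁻¹Q` is symmetric positive definite,
and `(Q, S, α)` satisfies the extended observability LMI. -/
theorem exists_symmS_extObsLMI {n m q : ℕ}
    (A : Matrix (Fin n) (Fin n) ℝ) (B : Matrix (Fin n) (Fin m) ℝ)
    (C : Matrix (Fin q) (Fin n) ℝ)
    (Q Γo : Matrix (Fin n) (Fin n) ℝ)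
    (hQ : Q.PosDef)
    (hXo : (-(Q * A) - Aᵀ * Q - Cᵀ * C).PosDef)
    (hΓ : Γoᵀ = Γo) :
    ∃ α₀ : ℝ, 0 < α₀ ∧ ∀ α : ℝ, α₀ ≤ α →
      (α • Q + Γo).PosDef ∧
      (Q * (α • Q + Γo)⁻¹ * Q).PosDef ∧
      extObsLMI A C Q (Q * (α • Q + Γo)⁻¹ * Q) α := by
  have hQt : Qᵀ = Q := hQ.isHermitian
  have hR : (Γo - Aᵀ * Q)ᴴ = Γo - Q * A := by simp [hQt, hΓ]
  obtain ⟨a, ha, haM⟩ := hQ.exists_forall_smul_add_posDef (H := Γo) hΓ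
  have hK : ((2 : ℝ) • Γo -
      (Γo - Aᵀ * Q)ᴴ * (-(Q * A) - Aᵀ * Q - Cᵀ * C)⁻¹ * (Γo - Aᵀ * Q)).IsHermitian :=
    (IsHermitian.smul hΓ (.all (2 : ℝ))).sub
      (isHermitian_conjTranspose_mul_mul _ hXo.inv.isHermitian)
  obtain ⟨b, -, hbK⟩ := hQ.exists_forall_smul_add_posDef hK
  refine ⟨max a b, lt_max_of_lt_left ha, fun α hα => ?_⟩
  have hM := haM α ((le_max_left _ _).trans hα)
  refine ⟨hM, ?_, extObsLMI_of_posSemidef hQt hΓ hM.isUnit ?_⟩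
  · simpa [hQt] using hM.inv.conjTranspose_mul_mul_same (mulVec_injective_of_isUnit hQ.isUnit)
  · let := hXo.isUnit.invertible
    rw [← hR, PosDef.fromBlocks₁₁ _ _ hXo]
    have hαb : b ≤ 2 * α := by linarith [le_max_left a b, le_max_right a b]
    convert! (hbK (2 * α) hαb).posSemidef using 1
    rw [smul_add, smul_smul]
    abel
end
end

section
/- Let δ > 0 and consider a CTLTI port-Hamiltonian system with matrices J, R, H ∈ ℝ^{n×n} (J skew-symmetric, R symmetric positive semidefinite, H symmetric positive definite), F := J − R, and B ∈ ℝ^{n×m}. If 2δR − BBᵀ ≥ 0, then Q := δH satisfies QFH + HFᵀQ + HBBᵀH ≤ 0 (i.e., Q is a generalized observability Gramian) and P̆ := δH^{−1} satisfies FHP̆ + P̆HFᵀ + BBᵀ ≤ 0 (i.e., P̆ is a generalized controllability Gramian). (Paper Proposition 2.) -/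
open Matrix

noncomputable section

/-- Paper Proposition 2: for a CTLTI port-Hamiltonian system with
`F = J − R`, if `2δR − BBᵀ ≥ 0` then `Q = δH` is a generalized observability Gramian
(`QFH + HFᵀQ + HBBᵀH ≤ 0`) and `P̆ = δH⁻¹` is a generalized controllability Gramian
(`FHP̆ + P̆HFᵀ + BBᵀ ≤ 0`). -/
theorem pH_scaled_hamiltonian_gramians {n m : ℕ} (δ : ℝ) (hδ : 0 < δ)
    (J R H : Matrix (Fin n) (Fin n) ℝ) (B : Matrix (Fin n) (Fin m) ℝ)
    (hJ : Jᵀ = -J) (hR : R.PosSemidef) (hH : H.PosDef)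
    (hcond : ((2 * δ) • R - B * Bᵀ).PosSemidef) :
    (-((δ • H) * (J - R) * H + H * (J - R)ᵀ * (δ • H) + H * B * Bᵀ * H)).PosSemidef ∧
    (-((J - R) * H * (δ • H⁻¹) + (δ • H⁻¹) * H * (J - R)ᵀ + B * Bᵀ)).PosSemidef := by
  have hHt : Hᴴ = H := hH.isHermitian
  have hRt : Rᵀ = R := by simpa using hR.isHermitian.eq
  have hdet : IsUnit H.det := (Matrix.isUnit_iff_isUnit_det H).mp hH.isUnit
  have hobs : -((δ • H) * (J - R) * H + H * (J - R)ᵀ * (δ • H) + H * B * Bᵀ * H) =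
      Hᴴ * ((2 * δ) • R - B * Bᵀ) * H := by
    rw [hHt, Matrix.transpose_sub, hJ, hRt]
    simp only [Matrix.mul_sub, Matrix.sub_mul, Matrix.smul_mul, Matrix.mul_smul,
      Matrix.mul_neg, Matrix.neg_mul, Matrix.mul_assoc]
    module
  have hctrl : -((J - R) * H * (δ • H⁻¹) + (δ • H⁻¹) * H * (J - R)ᵀ + B * Bᵀ) =
      (2 * δ) • R - B * Bᵀ := by
    rw [Matrix.mul_smul, Matrix.mul_nonsing_inv_cancel_right _ _ hdet, Matrix.smul_mul,
      Matrix.nonsing_inv_mul _ hdet, Matrix.smul_mul, Matrix.one_mul,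
      Matrix.transpose_sub, hJ, hRt]
    module
  rw [hobs, hctrl]
  exact ⟨hcond.conjTranspose_mul_mul_same H, hcond⟩
end
end

section
/- Let P̆ ∈ ℝ^{n×n} be symmetric positive definite with FHP̆ + P̆HFᵀ + BBᵀ ≤ 0. Let φ_P ∈ ℝ^{n×n} be invertible with P̆ = φ_Pᵀφ_P, and let U ∈ ℝ^{n×n} be orthogonal and Λ_HP diagonal with positive entries such that φ_P H φ_Pᵀ = U Λ_HP Uᵀ. Define ℱ_c := Uᵀφ_P^{−ᵀ}Fφ_P^{−1}U and ℬ_c := Uᵀφ_P^{−ᵀ}B. Suppose Λ_QP is a diagonal matrix with positive entries such that −Λ_QP²Λ_HP^{−1}ℱ_c − ℱ_cᵀΛ_HP^{−1}Λ_QP² − ℬ_cℬ_cᵀ ≥ 0. Then: (i) Q := φ_P^{−1}UΛ_QP²Uᵀφ_P^{−ᵀ} satisfies QFH + HFᵀQ + HBBᵀH ≤ 0; and (ii) the invertible matrix W := φ_PᵀUΛ_QP^{−1/2} satisfies WᵀQW = Λ_QP, W^{−1}P̆W^{−ᵀ} = Λ_QP, and WᵀHW = Λ_QP^{−1}Λ_HP,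 so W balances the system and diagonalizes H. (Paper Proposition 3.) -/
open Matrix

noncomputable section

/-- Transporting a Lyapunov inequality from the coordinates in which `H = V D Vᵀ` is diagonal
back to the original coordinates. -/
theorem posSemidef_lyapunov_of_congr {ι κ : Type*} [Fintype ι] [DecidableEq ι] [Fintype κ]
    {F D D' E V : Matrix ι ι ℝ} {B : Matrix ι κ ℝ} (hDD' : D * D' = 1) (hDT : Dᵀ = D)
    (hDE : D * E = E * D)
    (h : (-(E * D' * (Vᵀ * F * V) + (Vᵀ * F * V)ᵀ * D' * E
      + (Vᵀ * B) * (Vᵀ * B)ᵀ)).PosSemidef) :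
    (-((V * E * Vᵀ) * F * (V * D * Vᵀ) + (V * D * Vᵀ) * Fᵀ * (V * E * Vᵀ)
      + (V * D * Vᵀ) * B * Bᵀ * (V * D * Vᵀ))).PosSemidef := by
  have hD'D : D' * D = 1 := mul_eq_one_comm.mp hDD'
  have hl : D * (E * D') = E := by rw [← Matrix.mul_assoc, hDE, Matrix.mul_assoc, hDD', mul_one]
  have hr : D' * (E * D) = E := by rw [← hDE, ← Matrix.mul_assoc, hD'D, one_mul]
  have hl' (X : Matrix ι ι ℝ) : D * (E * (D' * X)) = E * X := by
    rw [← Matrix.mul_assoc E, ← Matrix.mul_assoc D, hl]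
  have hr' (X : Matrix ι ι ℝ) : D' * (E * (D * X)) = E * X := by
    rw [← Matrix.mul_assoc E, ← Matrix.mul_assoc D', hr]
  have key := h.mul_mul_conjTranspose_same (V * D)
  convert key using 1
  simp only [conjTranspose_eq_transpose_of_trivial, transpose_mul, transpose_transpose, hDT,
    Matrix.mul_neg, Matrix.neg_mul, Matrix.mul_add, Matrix.add_mul, Matrix.mul_assoc, hl', hr']

/-- Paper Proposition 3: given a generalized controllability Gramian
`P̆ = φ_Pᵀφ_P` of the port-Hamiltonian system `ẋ = FHx + Bu`, `y = BᵀHx` with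
`φ_P H φ_Pᵀ = U Λ_HP Uᵀ`, if a diagonal `Λ_QP > 0` satisfies
`−Λ_QP²Λ_HP⁻¹ℱ_c − ℱ_cᵀΛ_HP⁻¹Λ_QP² − ℬ_cℬ_cᵀ ≥ 0`, then
`Q = φ_P⁻¹UΛ_QP²Uᵀφ_P⁻ᵀ` is a generalized observability Gramian and
`W = φ_PᵀUΛ_QP^{−1/2}` balances the system and diagonalizes `H`. -/
theorem pH_generalized_balancing_from_ctrl {n m : ℕ}
    (J R H : Matrix (Fin n) (Fin n) ℝ) (B : Matrix (Fin n) (Fin m) ℝ)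
    (hJ : Jᵀ = -J) (hR : R.PosSemidef) (hH : H.PosDef)
    (Pb φ U : Matrix (Fin n) (Fin n) ℝ)
    (hPb : Pb.PosDef)
    (hLyap : (-((J - R) * H * Pb + Pb * H * (J - R)ᵀ + B * Bᵀ)).PosSemidef)
    (hφ : IsUnit φ) (hfact : Pb = φᵀ * φ)
    (hU : U * Uᵀ = 1)
    (d : Fin n → ℝ) (hd : ∀ i, 0 < d i)
    (hdiag : φ * H * φᵀ = U * Matrix.diagonal d * Uᵀ)
    (e : Fin n → ℝ) (he : ∀ i, 0 < e i)
    (hineq : (-((Matrix.diagonal e) ^ 2 * (Matrix.diagonal d)⁻¹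
          * (Uᵀ * (φ⁻¹)ᵀ * (J - R) * φ⁻¹ * U)
        + (Uᵀ * (φ⁻¹)ᵀ * (J - R) * φ⁻¹ * U)ᵀ * (Matrix.diagonal d)⁻¹
          * (Matrix.diagonal e) ^ 2
        + (Uᵀ * (φ⁻¹)ᵀ * B) * (Uᵀ * (φ⁻¹)ᵀ * B)ᵀ)).PosSemidef) :
    (-((φ⁻¹ * U * (Matrix.diagonal e) ^ 2 * Uᵀ * (φ⁻¹)ᵀ) * (J - R) * H
        + H * (J - R)ᵀ * (φ⁻¹ * U * (Matrix.diagonal e) ^ 2 * Uᵀ * (φ⁻¹)ᵀ)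
        + H * B * Bᵀ * H)).PosSemidef ∧
    IsUnit (φᵀ * U * Matrix.diagonal fun i => (Real.sqrt (e i))⁻¹) ∧
    (φᵀ * U * Matrix.diagonal fun i => (Real.sqrt (e i))⁻¹)ᵀ
        * (φ⁻¹ * U * (Matrix.diagonal e) ^ 2 * Uᵀ * (φ⁻¹)ᵀ)
        * (φᵀ * U * Matrix.diagonal fun i => (Real.sqrt (e i))⁻¹)
      = Matrix.diagonal e ∧
    (φᵀ * U * Matrix.diagonal fun i => (Real.sqrt (e i))⁻¹)⁻¹ * Pb
        * ((φᵀ * U * Matrix.diagonal fun i => (Real.sqrt (e i))⁻¹)⁻¹)ᵀ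
      = Matrix.diagonal e ∧
    (φᵀ * U * Matrix.diagonal fun i => (Real.sqrt (e i))⁻¹)ᵀ * H
        * (φᵀ * U * Matrix.diagonal fun i => (Real.sqrt (e i))⁻¹)
      = (Matrix.diagonal e)⁻¹ * Matrix.diagonal d := by
  have hU' : Uᵀ * U = 1 := mul_eq_one_comm.mp hU
  have hdet : IsUnit φ.det := (Matrix.isUnit_iff_isUnit_det φ).mp hφ
  have hφl : φ⁻¹ * φ = 1 := Matrix.nonsing_inv_mul φ hdet
  set V := φ⁻¹ * U with hV
  set T := Uᵀ * φ with hT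
  have hVT : V * T = 1 := by
    rw [hV, hT, Matrix.mul_assoc, ← Matrix.mul_assoc U, hU, one_mul, hφl]
  have hTV : T * V = 1 := mul_eq_one_comm.mp hVT
  have hVt : Uᵀ * (φ⁻¹)ᵀ = Vᵀ := by rw [hV, transpose_mul]
  have hTt : φᵀ * U = Tᵀ := by rw [hT, transpose_mul, transpose_transpose]
  have hVTt : Vᵀ * Tᵀ = 1 := by rw [← transpose_mul, hTV, transpose_one]
  have hTVt : Tᵀ * Vᵀ = 1 := mul_eq_one_comm.mp hVTt
  have hP : Pb = Tᵀ * T := by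
    rw [hfact, ← hTt, hT, Matrix.mul_assoc, ← Matrix.mul_assoc U, hU, one_mul]
  have hTH : T * H * Tᵀ = diagonal d := by
    calc T * H * Tᵀ = Uᵀ * (φ * H * φᵀ) * U := by rw [← hTt, hT]; simp only [Matrix.mul_assoc]
      _ = (Uᵀ * U) * diagonal d * (Uᵀ * U) := by rw [hdiag]; simp only [Matrix.mul_assoc]
      _ = diagonal d := by rw [hU', one_mul, mul_one]
  have hHV : H = V * diagonal d * Vᵀ := by
    calc H = (V * T) * H * (Tᵀ * Vᵀ) := by rw [hVT, hTVt, one_mul, mul_one]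
      _ = V * (T * H * Tᵀ) * Vᵀ := by simp only [Matrix.mul_assoc]
      _ = V * diagonal d * Vᵀ := by rw [hTH]
  have hQ : V * (diagonal e) ^ 2 * Uᵀ * (φ⁻¹)ᵀ = V * (diagonal e) ^ 2 * Vᵀ := by
    rw [Matrix.mul_assoc _ Uᵀ, hVt]
  have hF : Vᵀ * (J - R) * φ⁻¹ * U = Vᵀ * (J - R) * V := by
    rw [Matrix.mul_assoc _ φ⁻¹ U]
  have hs (i : Fin n) : √(e i) ≠ 0 := (Real.sqrt_pos.mpr (he i)).ne'
  have hss (i : Fin n) : √(e i) * √(e i) = e i := Real.mul_self_sqrt (he i).le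
  set S : Matrix (Fin n) (Fin n) ℝ := diagonal fun i => (√(e i))⁻¹ with hS
  have hSt : Sᵀ = S := diagonal_transpose _
  have hSr : S * diagonal (fun i => √(e i)) = 1 := by
    simp [hS, diagonal_mul_diagonal, hs]
  have hdinv : diagonal d * (diagonal d)⁻¹ = 1 :=
    Matrix.mul_nonsing_inv _ (by
      simpa [det_diagonal, Finset.prod_ne_zero_iff] using fun i => (hd i).ne')
  have heinv : (diagonal e)⁻¹ = diagonal fun i => (e i)⁻¹ :=
    Matrix.inv_eq_right_inv (by simp [diagonal_mul_diagonal, (he _).ne'])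
  have hWr : Tᵀ * S * (diagonal (fun i => √(e i)) * Vᵀ) = 1 := by
    rw [Matrix.mul_assoc, ← Matrix.mul_assoc S, hSr, one_mul, hTVt]
  rw [hVt, hF] at hineq
  rw [hQ, hTt]
  refine ⟨?_, IsUnit.of_mul_eq_one _ hWr, ?_, ?_, ?_⟩
  · rw [hHV]
    refine posSemidef_lyapunov_of_congr hdinv (diagonal_transpose d) ?_ hineq
    rw [diagonal_pow, diagonal_mul_diagonal, diagonal_mul_diagonal]
    simp only [mul_comm]
  · calc (Tᵀ * S)ᵀ * (V * (diagonal e) ^ 2 * Vᵀ) * (Tᵀ * S)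
        = S * (T * V) * (diagonal e) ^ 2 * (Vᵀ * Tᵀ) * S := by
          simp only [transpose_mul, transpose_transpose, hSt, Matrix.mul_assoc]
      _ = diagonal e := by
          rw [hTV, hVTt, mul_one, mul_one, diagonal_pow, hS, diagonal_mul_diagonal,
            diagonal_mul_diagonal]
          congr 1
          ext i
          have := hs i
          simp only [Pi.pow_apply]
          field_simp
          rw [Real.sq_sqrt (he i).le, sq]
  · rw [Matrix.inv_eq_right_inv hWr, hP]
    calc diagonal (fun i => √(e i)) * Vᵀ * (Tᵀ * T) * (diagonal (fun i => √(e i)) * Vᵀ)ᵀ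
        = diagonal (fun i => √(e i)) * (Vᵀ * Tᵀ) * (T * V) * diagonal (fun i => √(e i)) := by
          simp only [transpose_mul, transpose_transpose, diagonal_transpose, Matrix.mul_assoc]
      _ = diagonal e := by
          rw [hTV, hVTt, mul_one, mul_one, diagonal_mul_diagonal]
          simp only [hss]
  · calc (Tᵀ * S)ᵀ * H * (Tᵀ * S) = S * (T * H * Tᵀ) * S := by
          simp only [transpose_mul, transpose_transpose, hSt, Matrix.mul_assoc]
      _ = (diagonal e)⁻¹ * diagonal d := by
          rw [hTH, heinv, hS, diagonal_mul_diagonal, diagonal_mul_diagonal,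
            diagonal_mul_diagonal]
          congr 1
          ext i
          rw [mul_right_comm, ← mul_inv, hss]
end
end

section
/- Let Q ∈ ℝ^{n×n} be symmetric positive definite with QFH + HFᵀQ + HBBᵀH ≤ 0. Let φ_Q ∈ ℝ^{n×n} be invertible with Q = φ_Qᵀφ_Q, and let U ∈ ℝ^{n×n} be orthogonal and Λ_HQ diagonal with positive entries such that φ_Q^{−ᵀ}Hφ_Q^{−1} = U Λ_HQ Uᵀ. Define ℱ_o := Uᵀφ_QFφ_QᵀU and ℬ_o := Uᵀφ_QB. Suppose Λ_QP is a diagonal matrix with positive entries such that −ℱ_oΛ_HQΛ_QP² − Λ_QP²Λ_HQℱ_oᵀ − ℬ_oℬ_oᵀ ≥ 0. Then: (i) P̆ := φ_Q^{−1}UΛ_QP²Uᵀφ_Q^{−ᵀ} satisfies FHP̆ + P̆HFᵀ + BBᵀ ≤ 0; and (ii) the invertible matrix W := φ_Q^{−1}UΛ_QP^{1/2} satisfies WᵀQW = Λ_QP, W^{−1}P̆W^{−ᵀ} = Λ_QP, and WᵀHW = Λ_HQΛ_QP, so W balances the system and diagonalizes H. (Paper Proposition 4.) -/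
open Matrix

noncomputable section

/-- Paper Proposition 4: given a generalized observability Gramian
`Q = φ_Qᵀφ_Q` of the port-Hamiltonian system `ẋ = FHx + Bu`, `y = BᵀHx` with
`φ_Q⁻ᵀ H φ_Q⁻¹ = U Λ_HQ Uᵀ`, if a diagonal `Λ_QP > 0` satisfies
`−ℱ_oΛ_HQΛ_QP² − Λ_QP²Λ_HQℱ_oᵀ − ℬ_oℬ_oᵀ ≥ 0`, then
`P̆ = φ_Q⁻¹UΛ_QP²Uᵀφ_Q⁻ᵀ` is a generalized controllability Gramian and
`W = φ_Q⁻¹UΛ_QP^{1/2}` balances the system and diagonalizes `H`. -/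
theorem pH_generalized_balancing_from_obs {n m : ℕ}
    (J R H : Matrix (Fin n) (Fin n) ℝ) (B : Matrix (Fin n) (Fin m) ℝ)
    (hJ : Jᵀ = -J) (hR : R.PosSemidef) (hH : H.PosDef)
    (Q φ U : Matrix (Fin n) (Fin n) ℝ)
    (hQ : Q.PosDef)
    (hLyap : (-(Q * (J - R) * H + H * (J - R)ᵀ * Q + H * B * Bᵀ * H)).PosSemidef)
    (hφ : IsUnit φ) (hfact : Q = φᵀ * φ)
    (hU : U * Uᵀ = 1)
    (d : Fin n → ℝ) (hd : ∀ i, 0 < d i)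
    (hdiag : (φ⁻¹)ᵀ * H * φ⁻¹ = U * Matrix.diagonal d * Uᵀ)
    (e : Fin n → ℝ) (he : ∀ i, 0 < e i)
    (hineq : (-((Uᵀ * φ * (J - R) * φᵀ * U) * Matrix.diagonal d * (Matrix.diagonal e) ^ 2
        + (Matrix.diagonal e) ^ 2 * Matrix.diagonal d * (Uᵀ * φ * (J - R) * φᵀ * U)ᵀ
        + (Uᵀ * φ * B) * (Uᵀ * φ * B)ᵀ)).PosSemidef) :
    (-((J - R) * H * (φ⁻¹ * U * (Matrix.diagonal e) ^ 2 * Uᵀ * (φ⁻¹)ᵀ)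
        + (φ⁻¹ * U * (Matrix.diagonal e) ^ 2 * Uᵀ * (φ⁻¹)ᵀ) * H * (J - R)ᵀ
        + B * Bᵀ)).PosSemidef ∧
    IsUnit (φ⁻¹ * U * Matrix.diagonal fun i => Real.sqrt (e i)) ∧
    (φ⁻¹ * U * Matrix.diagonal fun i => Real.sqrt (e i))ᵀ * Q
        * (φ⁻¹ * U * Matrix.diagonal fun i => Real.sqrt (e i))
      = Matrix.diagonal e ∧
    (φ⁻¹ * U * Matrix.diagonal fun i => Real.sqrt (e i))⁻¹
        * (φ⁻¹ * U * (Matrix.diagonal e) ^ 2 * Uᵀ * (φ⁻¹)ᵀ)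
        * ((φ⁻¹ * U * Matrix.diagonal fun i => Real.sqrt (e i))⁻¹)ᵀ
      = Matrix.diagonal e ∧
    (φ⁻¹ * U * Matrix.diagonal fun i => Real.sqrt (e i))ᵀ * H
        * (φ⁻¹ * U * Matrix.diagonal fun i => Real.sqrt (e i))
      = Matrix.diagonal d * Matrix.diagonal e := by
  set T := φ⁻¹ * U with hT
  set S := Uᵀ * φ with hS
  set W := T * Matrix.diagonal fun i => Real.sqrt (e i) with hW
  set V := (Matrix.diagonal fun i => (Real.sqrt (e i))⁻¹) * S with hV
  have hdet : IsUnit φ.det := (Matrix.isUnit_iff_isUnit_det φ).mp hφ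
  have hU' : Uᵀ * U = 1 := mul_eq_one_comm.mp hU
  have hφl : φ⁻¹ * φ = 1 := Matrix.nonsing_inv_mul φ hdet
  have hφr : φ * φ⁻¹ = 1 := Matrix.mul_nonsing_inv φ hdet
  have hST : S * T = 1 := by
    rw [hS, hT, Matrix.mul_assoc, ← Matrix.mul_assoc φ, hφr, Matrix.one_mul, hU']
  have hTS : T * S = 1 := mul_eq_one_comm.mp hST
  have hTS' : Sᵀ * Tᵀ = 1 := by rw [← Matrix.transpose_mul, hTS, Matrix.transpose_one]
  have hST' : Tᵀ * Sᵀ = 1 := by rw [← Matrix.transpose_mul, hST, Matrix.transpose_one]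
  have hsqrt (i : Fin n) : Real.sqrt (e i) ≠ 0 := (Real.sqrt_pos.mpr (he i)).ne'
  have hsq (i : Fin n) : Real.sqrt (e i) * Real.sqrt (e i) = e i :=
    Real.mul_self_sqrt (he i).le
  have hQS : Q = Sᵀ * S := by
    rw [hfact, hS, Matrix.transpose_mul, Matrix.transpose_transpose, Matrix.mul_assoc,
      ← Matrix.mul_assoc U, hU, Matrix.one_mul]
  have hHS : H = Sᵀ * Matrix.diagonal d * S := by
    have hφt : φᵀ * (φ⁻¹)ᵀ = 1 := by rw [← Matrix.transpose_mul, hφl, Matrix.transpose_one]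
    calc H = (φᵀ * (φ⁻¹)ᵀ) * H * (φ⁻¹ * φ) := by
            rw [hφt, hφl, Matrix.one_mul, Matrix.mul_one]
      _ = φᵀ * ((φ⁻¹)ᵀ * H * φ⁻¹) * φ := by simp only [Matrix.mul_assoc]
      _ = Sᵀ * Matrix.diagonal d * S := by
        rw [hdiag, hS, Matrix.transpose_mul, Matrix.transpose_transpose]
        simp only [Matrix.mul_assoc]
  have hSt : φᵀ * U = Sᵀ := by
    rw [hS, Matrix.transpose_mul, Matrix.transpose_transpose]
  have hFo : S * (J - R) * φᵀ * U = S * (J - R) * Sᵀ := by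
    rw [Matrix.mul_assoc _ φᵀ U, hSt]
  have hP : T * Matrix.diagonal e ^ 2 * Uᵀ * (φ⁻¹)ᵀ = T * Matrix.diagonal e ^ 2 * Tᵀ := by
    rw [hT, Matrix.transpose_mul φ⁻¹ U]
    simp only [Matrix.mul_assoc]
  have hcancel {k : ℕ} (X : Matrix (Fin n) (Fin k) ℝ) : S * (T * X) = X := by
    rw [← Matrix.mul_assoc, hST, Matrix.one_mul]
  have hcancel' {k : ℕ} (X : Matrix (Fin n) (Fin k) ℝ) : T * (S * X) = X := by
    rw [← Matrix.mul_assoc, hTS, Matrix.one_mul]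
  have hcancelt {k : ℕ} (X : Matrix (Fin n) (Fin k) ℝ) : Tᵀ * (Sᵀ * X) = X := by
    rw [← Matrix.mul_assoc, hST', Matrix.one_mul]
  have hVW : V * W = 1 := by
    rw [hV, hW, Matrix.mul_assoc, hcancel, Matrix.diagonal_mul_diagonal, ← Matrix.diagonal_one]
    congr 1
    funext i
    exact inv_mul_cancel₀ (hsqrt i)
  have hWV : W * V = 1 := mul_eq_one_comm.mp hVW
  have hWinv : W⁻¹ = V := Matrix.inv_eq_left_inv hVW
  rw [hP, hWinv]
  rw [hFo] at hineq
  clear_value S T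
  refine ⟨?_, IsUnit.of_mul_eq_one V hWV, ?_, ?_, ?_⟩
  · have key := hineq.mul_mul_conjTranspose_same T
    rw [Matrix.conjTranspose_eq_transpose_of_trivial] at key
    convert key using 1
    rw [hHS]
    simp only [Matrix.mul_neg, Matrix.neg_mul, Matrix.mul_add, Matrix.add_mul,
      Matrix.transpose_mul, Matrix.transpose_transpose, Matrix.mul_assoc, hcancel, hcancel',
      hcancelt, hTS', Matrix.mul_one]
  · rw [hW, hQS]
    simp only [Matrix.transpose_mul, Matrix.diagonal_transpose, Matrix.mul_assoc, hcancel,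
      hcancelt, Matrix.diagonal_mul_diagonal, hsq]
  · rw [hV]
    simp only [Matrix.transpose_mul, Matrix.diagonal_transpose, Matrix.mul_assoc, hcancel,
      hcancelt, pow_two, Matrix.diagonal_mul_diagonal]
    congr 1
    funext i
    field_simp [hsqrt i]
    rw [Real.sq_sqrt (he i).le, pow_two]
  · rw [hW, hHS]
    simp only [Matrix.transpose_mul, Matrix.diagonal_transpose, Matrix.mul_assoc, hcancel,
      hcancelt, Matrix.diagonal_mul_diagonal]
    congr 1
    funext i
    rw [← hsq i]
    simp only [Real.sqrt_mul_self (Real.sqrt_nonneg _)]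
    ring
end
end

section
/- Consider the CTLTI port-Hamiltonian system with A = FH, C = BᵀH. Let T ∈ ℝ^{n×n} be symmetric positive definite, let φ_T ∈ ℝ^{n×n} be invertible with T^{−1} = φ_Tᵀφ_T, and let U orthogonal and Λ_HT diagonal with positive entries satisfy φ_T H φ_Tᵀ = U Λ_HT Uᵀ. Define ℱ_ec := Uᵀφ_T^{−ᵀ}Fφ_T^{−1}U and ℬ_ec := Uᵀφ_T^{−ᵀ}B, and suppose Λ_QT is a diagonal matrix with positive entries such that −Λ_QT²Λ_HT^{−1}ℱ_ec − ℱ_ecᵀΛ_HT^{−1}Λ_QT² − ℬ_ecℬ_ecᵀ > 0 (positive definite). Then: (i) Q := φ_T^{−1}UΛ_QT²Uᵀφ_T^{−ᵀ} satisfies QFH + HFᵀQ + HBBᵀH ≤ 0; and (ii) for any α > 0, setting S := (1/α)Q and Λ_ST := (1/√α)Λ_QT, the invertible matrix W := α^{1/4}φ_TᵀUΛ_QT^{−1/2} satisfies W^{−1}T^{−1}SW = Λ_ST² and WᵀHW = Λ_HTΛ_ST^{−1}, so W balances the system (in the extended sense) and diagonalizes H. (Paper Proposition 5.) -/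
open Matrix

noncomputable section

/-- Congruence by `V` and `D = diagonal d` turns the balanced Lyapunov form into the original one. -/
lemma lyapunov_form_congruence {n m : ℕ} (F H Q V : Matrix (Fin n) (Fin n) ℝ)
    (B : Matrix (Fin n) (Fin m) ℝ) (d e : Fin n → ℝ) (hd : ∀ i, 0 < d i)
    (hH : H = V * diagonal d * Vᵀ) (hQ : Q = V * diagonal e ^ 2 * Vᵀ) :
    -(Q * F * H + H * Fᵀ * Q + H * B * Bᵀ * H) =
      (V * diagonal d) *
        (-(diagonal e ^ 2 * (diagonal d)⁻¹ * (Vᵀ * F * V)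
          + (Vᵀ * F * V)ᵀ * (diagonal d)⁻¹ * diagonal e ^ 2 + (Vᵀ * B) * (Vᵀ * B)ᵀ)) *
        (V * diagonal d)ᵀ := by
  have hu : IsUnit (diagonal d).det := by
    rw [det_diagonal]
    exact (Finset.prod_ne_zero_iff.mpr fun i _ => (hd i).ne').isUnit
  have hc : diagonal d * diagonal e ^ 2 = diagonal e ^ 2 * diagonal d := by
    simp [diagonal_pow, diagonal_mul_diagonal, mul_comm]
  have h₁ : diagonal d * (diagonal e ^ 2 * (diagonal d)⁻¹) = diagonal e ^ 2 := by
    rw [← mul_assoc, hc, mul_assoc, mul_nonsing_inv _ hu, mul_one]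
  have h₂ : (diagonal d)⁻¹ * (diagonal e ^ 2 * diagonal d) = diagonal e ^ 2 := by
    rw [← hc, ← mul_assoc, nonsing_inv_mul _ hu, one_mul]
  have h₁' (X : Matrix (Fin n) (Fin n) ℝ) :
      diagonal d * (diagonal e ^ 2 * ((diagonal d)⁻¹ * X)) = diagonal e ^ 2 * X := by
    rw [← mul_assoc (diagonal e ^ 2), ← mul_assoc (diagonal d), h₁]
  have h₂' (X : Matrix (Fin n) (Fin n) ℝ) :
      (diagonal d)⁻¹ * (diagonal e ^ 2 * (diagonal d * X)) = diagonal e ^ 2 * X := by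
    rw [← mul_assoc (diagonal e ^ 2), ← mul_assoc (diagonal d)⁻¹, h₂]
  subst hH hQ
  simp only [transpose_mul, transpose_transpose, diagonal_transpose, Matrix.mul_assoc,
    Matrix.mul_neg, Matrix.neg_mul, Matrix.mul_add, Matrix.add_mul, h₁', h₂']

/-- A real matrix of the form `c • (P * diagonal g)` with `P` invertible is invertible. -/
lemma isUnit_smul_mul_diagonal {n : ℕ} {P : Matrix (Fin n) (Fin n) ℝ} (hP : IsUnit P) {c : ℝ}
    (hc : c ≠ 0) {g : Fin n → ℝ} (hg : ∀ i, g i ≠ 0) : IsUnit (c • (P * diagonal g)) := by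
  rw [isUnit_iff_isUnit_det] at hP ⊢
  rw [det_smul, det_mul, det_diagonal]
  exact ((pow_ne_zero _ hc).isUnit).mul
    (hP.mul (Finset.prod_ne_zero_iff.mpr fun i _ => hg i).isUnit)

/-- Paper Proposition 5: given a symmetric positive definite `T` with
`T⁻¹ = φ_Tᵀφ_T` and `φ_T H φ_Tᵀ = U Λ_HT Uᵀ`, if a diagonal `Λ_QT > 0` satisfies
`−Λ_QT²Λ_HT⁻¹ℱ_ec − ℱ_ecᵀΛ_HT⁻¹Λ_QT² − ℬ_ecℬ_ecᵀ > 0`, then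
`Q = φ_T⁻¹UΛ_QT²Uᵀφ_T⁻ᵀ` solves the observability Lyapunov inequality, and for any
`α > 0`, with `S = (1/α)Q` and `Λ_ST = (1/√α)Λ_QT`, the matrix
`W = α^{1/4}φ_TᵀUΛ_QT^{−1/2}` satisfies `W⁻¹T⁻¹SW = Λ_ST²` and `WᵀHW = Λ_HTΛ_ST⁻¹`,
i.e. it balances the system in the extended sense and diagonalizes `H`. -/
theorem pH_extended_balancing_from_ctrl {n m : ℕ}
    (J R H : Matrix (Fin n) (Fin n) ℝ) (B : Matrix (Fin n) (Fin m) ℝ)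
    (hJ : Jᵀ = -J) (hR : R.PosSemidef) (hH : H.PosDef)
    (T φ U : Matrix (Fin n) (Fin n) ℝ)
    (hT : T.PosDef)
    (hφ : IsUnit φ) (hfact : T⁻¹ = φᵀ * φ)
    (hU : U * Uᵀ = 1)
    (d : Fin n → ℝ) (hd : ∀ i, 0 < d i)
    (hdiag : φ * H * φᵀ = U * Matrix.diagonal d * Uᵀ)
    (e : Fin n → ℝ) (he : ∀ i, 0 < e i)
    (hineq : (-((Matrix.diagonal e) ^ 2 * (Matrix.diagonal d)⁻¹
          * (Uᵀ * (φ⁻¹)ᵀ * (J - R) * φ⁻¹ * U)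
        + (Uᵀ * (φ⁻¹)ᵀ * (J - R) * φ⁻¹ * U)ᵀ * (Matrix.diagonal d)⁻¹
          * (Matrix.diagonal e) ^ 2
        + (Uᵀ * (φ⁻¹)ᵀ * B) * (Uᵀ * (φ⁻¹)ᵀ * B)ᵀ)).PosDef) :
    (-((φ⁻¹ * U * (Matrix.diagonal e) ^ 2 * Uᵀ * (φ⁻¹)ᵀ) * (J - R) * H
        + H * (J - R)ᵀ * (φ⁻¹ * U * (Matrix.diagonal e) ^ 2 * Uᵀ * (φ⁻¹)ᵀ)
        + H * B * Bᵀ * H)).PosSemidef ∧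
    ∀ α : ℝ, 0 < α →
      IsUnit ((α ^ ((1 : ℝ) / 4)) • (φᵀ * U * Matrix.diagonal fun i => (Real.sqrt (e i))⁻¹)) ∧
      ((α ^ ((1 : ℝ) / 4)) • (φᵀ * U * Matrix.diagonal fun i => (Real.sqrt (e i))⁻¹))⁻¹
          * T⁻¹
          * ((1 / α) • (φ⁻¹ * U * (Matrix.diagonal e) ^ 2 * Uᵀ * (φ⁻¹)ᵀ))
          * ((α ^ ((1 : ℝ) / 4)) • (φᵀ * U * Matrix.diagonal fun i => (Real.sqrt (e i))⁻¹))
        = (Matrix.diagonal fun i => e i / Real.sqrt α) ^ 2 ∧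
      ((α ^ ((1 : ℝ) / 4)) • (φᵀ * U * Matrix.diagonal fun i => (Real.sqrt (e i))⁻¹))ᵀ
          * H
          * ((α ^ ((1 : ℝ) / 4)) • (φᵀ * U * Matrix.diagonal fun i => (Real.sqrt (e i))⁻¹))
        = Matrix.diagonal d * (Matrix.diagonal fun i => e i / Real.sqrt α)⁻¹ := by
  have hφd := (isUnit_iff_isUnit_det φ).mp hφ
  have hU' : Uᵀ * U = 1 := mul_eq_one_comm.mp hU
  set V := φ⁻¹ * U with hV
  set P := φᵀ * U with hPdef
  clear_value V P
  have hVt : Uᵀ * (φ⁻¹)ᵀ = Vᵀ := by rw [hV, transpose_mul]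
  have hPt : Pᵀ = Uᵀ * φ := by rw [hPdef, transpose_mul, transpose_transpose]
  have hPV : Pᵀ * V = 1 := by
    rw [hPt, hV, Matrix.mul_assoc, mul_nonsing_inv_cancel_left _ _ hφd, hU']
  have hVP : Vᵀ * P = 1 := by
    rw [← transpose_one, ← hPV, transpose_mul, transpose_transpose]
  have hVP' : V * Pᵀ = 1 := mul_eq_one_comm.mp hPV
  have hPV' : P * Vᵀ = 1 := mul_eq_one_comm.mp hVP
  have hPH : Pᵀ * H * P = diagonal d := by
    calc Pᵀ * H * P = Uᵀ * (φ * H * φᵀ) * U := by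
          rw [hPt, hPdef]; simp only [Matrix.mul_assoc]
      _ = (Uᵀ * U) * diagonal d * (Uᵀ * U) := by
          rw [hdiag]; simp only [Matrix.mul_assoc]
      _ = diagonal d := by rw [hU', one_mul, mul_one]
  have hHV : H = V * diagonal d * Vᵀ := by
    calc H = (V * Pᵀ) * H * (P * Vᵀ) := by rw [hVP', hPV', one_mul, mul_one]
      _ = V * (Pᵀ * H * P) * Vᵀ := by simp only [Matrix.mul_assoc]
      _ = V * diagonal d * Vᵀ := by rw [hPH]
  have hTP : T⁻¹ = P * Pᵀ := by
    rw [hfact, hPt, hPdef, Matrix.mul_assoc, ← Matrix.mul_assoc U, hU, one_mul]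
  have hQV : V * diagonal e ^ 2 * Uᵀ * (φ⁻¹)ᵀ = V * diagonal e ^ 2 * Vᵀ := by
    rw [Matrix.mul_assoc _ Uᵀ, hVt]
  have hF : Uᵀ * (φ⁻¹)ᵀ * (J - R) * φ⁻¹ * U = Vᵀ * (J - R) * V := by
    rw [hVt, Matrix.mul_assoc _ φ⁻¹, ← hV]
  rw [hF, hVt] at hineq
  rw [hQV]
  refine ⟨?_, fun α hα => ?_⟩
  · rw [lyapunov_form_congruence (J - R) H _ V B d e hd hHV rfl]
    simpa only [conjTranspose_eq_transpose_of_trivial] using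
      hineq.posSemidef.mul_mul_conjTranspose_same (V * diagonal d)
  set c : ℝ := α ^ ((1 : ℝ) / 4) with hc
  have hc0 : c ≠ 0 := (Real.rpow_pos_of_pos hα _).ne'
  have hcc : c * c = √α := by
    rw [hc, ← Real.rpow_add hα, Real.sqrt_eq_rpow]; norm_num
  have hse (i : Fin n) : √(e i) ≠ 0 := (Real.sqrt_pos.mpr (he i)).ne'
  have hW : IsUnit (c • (P * diagonal fun i => (√(e i))⁻¹)) :=
    isUnit_smul_mul_diagonal (IsUnit.of_mul_eq_one _ hPV') hc0 fun i => inv_ne_zero (hse i)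
  have hsα : √α ≠ 0 := (Real.sqrt_pos.mpr hα).ne'
  refine ⟨hW, ?_, ?_⟩
  · rw [Matrix.mul_assoc, Matrix.mul_assoc]
    have key : T⁻¹ * (((1 / α) • (V * diagonal e ^ 2 * Vᵀ)) *
        (c • (P * diagonal fun i => (√(e i))⁻¹))) =
        (c • (P * diagonal fun i => (√(e i))⁻¹)) * (diagonal fun i => e i / √α) ^ 2 := by
      calc _ = (c * (1 / α)) • (P * (Pᵀ * V) * (diagonal e ^ 2 * (Vᵀ * P) *
            diagonal fun i => (√(e i))⁻¹)) := by
            rw [hTP]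
            simp only [Matrix.smul_mul, Matrix.mul_smul, smul_smul, Matrix.mul_assoc]
        _ = c • (P * ((diagonal fun i => (√(e i))⁻¹) * (diagonal fun i => e i / √α) ^ 2)) := by
            rw [hPV, hVP, mul_one, mul_one, mul_smul, ← Matrix.mul_smul]
            congr 2
            simp only [diagonal_pow, diagonal_mul_diagonal, ← diagonal_smul]
            congr 1
            ext i
            simp only [Pi.smul_apply, Pi.pow_apply, smul_eq_mul, div_pow, Real.sq_sqrt hα.le]
            ring
        _ = _ := by rw [Matrix.smul_mul, Matrix.mul_assoc]
    rw [key, nonsing_inv_mul_cancel_left _ _ ((isUnit_iff_isUnit_det _).mp hW)]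
  · have hinv : (diagonal fun i => e i / √α)⁻¹ = diagonal fun i => √α / e i := by
      refine inv_eq_right_inv ?_
      rw [diagonal_mul_diagonal, ← diagonal_one]
      congr 1
      ext i
      have := (he i).ne'
      field_simp
    calc _ = (c * c) • ((diagonal fun i => (√(e i))⁻¹) * (Pᵀ * H * P) *
          diagonal fun i => (√(e i))⁻¹) := by
          simp only [transpose_smul, transpose_mul, diagonal_transpose, Matrix.smul_mul,
            Matrix.mul_smul, smul_smul, Matrix.mul_assoc]
      _ = _ := by
          rw [hPH, hcc, hinv]
          simp only [diagonal_mul_diagonal, ← diagonal_smul]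
          congr 1
          ext i
          have := hse i
          have h := Real.mul_self_sqrt (he i).le
          simp only [Pi.smul_apply, smul_eq_mul]
          rw [← h, Real.sqrt_mul_self (Real.sqrt_nonneg _)]
          field_simp
end
end

section
/- Consider the CTLTI port-Hamiltonian system with A = FH, C = BᵀH. Let S ∈ ℝ^{n×n} be symmetric positive definite, let φ_S ∈ ℝ^{n×n} be invertible with S = φ_Sᵀφ_S, and let U orthogonal and Λ_HS diagonal with positive entries satisfy φ_S^{−ᵀ}Hφ_S^{−1} = U Λ_HS Uᵀ. Define ℱ_eo := Uᵀφ_SFφ_SᵀU and ℬ_eo := Uᵀφ_SB, and suppose Λ_SP is a diagonal matrix with positive entries such that −ℱ_eoΛ_HSΛ_SP² − Λ_SP²Λ_HSℱ_eoᵀ − ℬ_eoℬ_eoᵀ > 0 (positive definite). Then: (i) P̆ := φ_S^{−1}UΛ_SP²Uᵀφ_S^{−ᵀ} satisfies FHP̆ + P̆HFᵀ + BBᵀ ≤ 0; and (ii) for any β > 0, setting T := (βP̆)^{−1} and Λ_ST := √β Λ_SP, the invertible matrix W := β^{1/4}φ_S^{−1}UΛ_SP^{1/2} satisfies W^{−1}T^{−1}SW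 = Λ_ST² and WᵀHW = Λ_HSΛ_ST, so W balances the system (in the extended sense) and diagonalizes H. (Paper Proposition 6.) -/
open Matrix

noncomputable section

section

variable {ι κ : Type*} [Fintype ι] [DecidableEq ι] [Fintype κ]

/-- Congruence by an invertible `V` carries the Lyapunov inequality in the coordinates
`V⁻¹` back to the original coordinates. -/
theorem lyapunov_posSemidef_of_congruence
    {V K F H D E : Matrix ι ι ℝ} {B : Matrix ι κ ℝ} (hVK : V * K = 1)
    (hH : H = Kᵀ * D * K)
    (h : (-((K * F * Kᵀ) * D * E + E * D * (K * F * Kᵀ)ᵀ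
      + (K * B) * (K * B)ᵀ)).PosSemidef) :
    (-(F * H * (V * E * Vᵀ) + (V * E * Vᵀ) * H * Fᵀ + B * Bᵀ)).PosSemidef := by
  have hKV : K * V = 1 := mul_eq_one_comm.mp hVK
  have hT : Vᵀ * Kᵀ = 1 := by rw [← transpose_mul, hKV, transpose_one]
  have hT' : Kᵀ * Vᵀ = 1 := by rw [← transpose_mul, hVK, transpose_one]
  have c1 (X : Matrix ι ι ℝ) : V * (K * X) = X := by rw [← Matrix.mul_assoc, hVK, Matrix.one_mul]
  have c2 (X : Matrix ι ι ℝ) : K * (V * X) = X := by rw [← Matrix.mul_assoc, hKV, Matrix.one_mul]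
  have c3 (X : Matrix ι ι ℝ) : Vᵀ * (Kᵀ * X) = X := by rw [← Matrix.mul_assoc, hT, Matrix.one_mul]
  have key := h.mul_mul_conjTranspose_same V
  rw [conjTranspose_eq_transpose_of_trivial] at key
  convert key using 1
  rw [hH]
  simp only [transpose_mul, transpose_transpose, Matrix.mul_neg, Matrix.neg_mul,
    Matrix.mul_add, Matrix.add_mul, Matrix.mul_assoc, c1, c2, c3, hT', Matrix.mul_one]

/-- In coordinates in which `S` is the identity, the controllability factor `E`
determines the balanced product `P * S`. -/
theorem inv_mul_gram_mul_eq {V K E Q : Matrix ι ι ℝ} (hVK : V * K = 1)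
    (hQ : IsUnit Q) (hEQ : Commute E Q) {c : ℝ} (hc : c ≠ 0) (b : ℝ) :
    (c • (V * Q))⁻¹ * (b • (V * E * Vᵀ)) * (Kᵀ * K) * (c • (V * Q)) = b • E := by
  have hKV : K * V = 1 := mul_eq_one_comm.mp hVK
  have hT : Vᵀ * Kᵀ = 1 := by rw [← transpose_mul, hKV, transpose_one]
  have c2 (X : Matrix ι ι ℝ) : K * (V * X) = X := by rw [← Matrix.mul_assoc, hKV, Matrix.one_mul]
  have c3 (X : Matrix ι ι ℝ) : Vᵀ * (Kᵀ * X) = X := by rw [← Matrix.mul_assoc, hT, Matrix.one_mul]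
  have hV : IsUnit V := IsUnit.of_mul_eq_one K hVK
  have hW : IsUnit (c • (V * Q)) := (hV.mul hQ).smul (Units.mk0 c hc)
  have hdet := (isUnit_iff_isUnit_det _).mp hW
  have hcomm : (b • (V * E * Vᵀ)) * (Kᵀ * K) * (c • (V * Q)) = (c • (V * Q)) * (b • E) := by
    simp only [Matrix.smul_mul, Matrix.mul_smul, Matrix.mul_assoc, c2, c3, hEQ.eq]
    rw [smul_comm]
  rw [Matrix.mul_assoc, Matrix.mul_assoc, ← Matrix.mul_assoc (b • _), hcomm,
    nonsing_inv_mul_cancel_left _ _ hdet]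

end

/-- Paper Proposition 6: given a symmetric positive definite `S` with
`S = φ_Sᵀφ_S` and `φ_S⁻ᵀ H φ_S⁻¹ = U Λ_HS Uᵀ`, if a diagonal `Λ_SP > 0` satisfies
`−ℱ_eoΛ_HSΛ_SP² − Λ_SP²Λ_HSℱ_eoᵀ − ℬ_eoℬ_eoᵀ > 0`, then
`P̆ = φ_S⁻¹UΛ_SP²Uᵀφ_S⁻ᵀ` solves the controllability Lyapunov inequality, and for any
`β > 0`, with `T = (βP̆)⁻¹` and `Λ_ST = √β Λ_SP`, the matrix
`W = β^{1/4}φ_S⁻¹UΛ_SP^{1/2}` satisfies `W⁻¹T⁻¹SW = Λ_ST²` and `WᵀHW = Λ_HSΛ_ST`,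
i.e. it balances the system in the extended sense and diagonalizes `H`. -/
theorem pH_extended_balancing_from_obs {n m : ℕ}
    (J R H : Matrix (Fin n) (Fin n) ℝ) (B : Matrix (Fin n) (Fin m) ℝ)
    (hJ : Jᵀ = -J) (hR : R.PosSemidef) (hH : H.PosDef)
    (S φ U : Matrix (Fin n) (Fin n) ℝ)
    (hS : S.PosDef)
    (hφ : IsUnit φ) (hfact : S = φᵀ * φ)
    (hU : U * Uᵀ = 1)
    (d : Fin n → ℝ) (hd : ∀ i, 0 < d i)
    (hdiag : (φ⁻¹)ᵀ * H * φ⁻¹ = U * Matrix.diagonal d * Uᵀ)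
    (e : Fin n → ℝ) (he : ∀ i, 0 < e i)
    (hineq : (-((Uᵀ * φ * (J - R) * φᵀ * U) * Matrix.diagonal d * (Matrix.diagonal e) ^ 2
        + (Matrix.diagonal e) ^ 2 * Matrix.diagonal d * (Uᵀ * φ * (J - R) * φᵀ * U)ᵀ
        + (Uᵀ * φ * B) * (Uᵀ * φ * B)ᵀ)).PosDef) :
    (-((J - R) * H * (φ⁻¹ * U * (Matrix.diagonal e) ^ 2 * Uᵀ * (φ⁻¹)ᵀ)
        + (φ⁻¹ * U * (Matrix.diagonal e) ^ 2 * Uᵀ * (φ⁻¹)ᵀ) * H * (J - R)ᵀ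
        + B * Bᵀ)).PosSemidef ∧
    ∀ β : ℝ, 0 < β →
      IsUnit ((β ^ ((1 : ℝ) / 4)) • (φ⁻¹ * U * Matrix.diagonal fun i => Real.sqrt (e i))) ∧
      ((β ^ ((1 : ℝ) / 4)) • (φ⁻¹ * U * Matrix.diagonal fun i => Real.sqrt (e i)))⁻¹
          * ((β • (φ⁻¹ * U * (Matrix.diagonal e) ^ 2 * Uᵀ * (φ⁻¹)ᵀ))⁻¹)⁻¹
          * S
          * ((β ^ ((1 : ℝ) / 4)) • (φ⁻¹ * U * Matrix.diagonal fun i => Real.sqrt (e i)))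
        = (Matrix.diagonal fun i => Real.sqrt β * e i) ^ 2 ∧
      ((β ^ ((1 : ℝ) / 4)) • (φ⁻¹ * U * Matrix.diagonal fun i => Real.sqrt (e i)))ᵀ
          * H
          * ((β ^ ((1 : ℝ) / 4)) • (φ⁻¹ * U * Matrix.diagonal fun i => Real.sqrt (e i)))
        = Matrix.diagonal d * Matrix.diagonal fun i => Real.sqrt β * e i := by
  have hU' : Uᵀ * U = 1 := mul_eq_one_comm.mp hU
  have hφd := (isUnit_iff_isUnit_det _).mp hφ
  have hVK : φ⁻¹ * U * (Uᵀ * φ) = 1 := by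
    rw [Matrix.mul_assoc, ← Matrix.mul_assoc U, hU, Matrix.one_mul, nonsing_inv_mul _ hφd]
  have hKV : Uᵀ * φ * (φ⁻¹ * U) = 1 := mul_eq_one_comm.mp hVK
  have hKT : φᵀ * U = (Uᵀ * φ)ᵀ := by rw [transpose_mul, transpose_transpose]
  have hVT : Uᵀ * (φ⁻¹)ᵀ = (φ⁻¹ * U)ᵀ := (transpose_mul _ _).symm
  have hHK : H = (Uᵀ * φ)ᵀ * diagonal d * (Uᵀ * φ) := by
    have hφT : φᵀ * (φ⁻¹)ᵀ = 1 := by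
      rw [← transpose_mul, nonsing_inv_mul _ hφd, transpose_one]
    calc H = φᵀ * (φ⁻¹)ᵀ * H * (φ⁻¹ * φ) := by
          rw [hφT, nonsing_inv_mul _ hφd, Matrix.one_mul, Matrix.mul_one]
      _ = φᵀ * ((φ⁻¹)ᵀ * H * φ⁻¹) * φ := by simp only [Matrix.mul_assoc]
      _ = _ := by rw [hdiag, ← hKT]; simp only [Matrix.mul_assoc]
  have hSK : S = (Uᵀ * φ)ᵀ * (Uᵀ * φ) := by
    rw [hfact, ← hKT, Matrix.mul_assoc, ← Matrix.mul_assoc U, hU, Matrix.one_mul]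
  have hP : φ⁻¹ * U * diagonal e ^ 2 * Uᵀ * (φ⁻¹)ᵀ
      = (φ⁻¹ * U) * diagonal e ^ 2 * (φ⁻¹ * U)ᵀ := by
    rw [← hVT, ← Matrix.mul_assoc]
  have hF : Uᵀ * φ * (J - R) * φᵀ * U = (Uᵀ * φ) * (J - R) * (Uᵀ * φ)ᵀ := by
    rw [← hKT, ← Matrix.mul_assoc]
  rw [hF] at hineq
  rw [hP]
  refine ⟨lyapunov_posSemidef_of_congruence hVK hHK hineq.posSemidef, fun β hβ => ?_⟩
  have hc : β ^ ((1 : ℝ) / 4) ≠ 0 := (Real.rpow_pos_of_pos hβ _).ne'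
  have hcc : β ^ ((1 : ℝ) / 4) * β ^ ((1 : ℝ) / 4) = √β := by
    rw [← Real.rpow_add hβ, Real.sqrt_eq_rpow]
    norm_num
  have hV : IsUnit (φ⁻¹ * U) := IsUnit.of_mul_eq_one _ hVK
  have hQ : IsUnit (diagonal fun i => √(e i)) := by
    rw [isUnit_diagonal, Pi.isUnit_iff]
    exact fun i => (Real.sqrt_pos.mpr (he i)).ne'.isUnit
  have hEu : IsUnit (diagonal e) := by
    rw [isUnit_diagonal, Pi.isUnit_iff]
    exact fun i => (he i).ne'.isUnit
  have hPu : IsUnit (β • ((φ⁻¹ * U) * diagonal e ^ 2 * (φ⁻¹ * U)ᵀ)) :=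
    ((hV.mul (hEu.pow 2)).mul ((isUnit_transpose _).mpr hV)).smul (Units.mk0 β hβ.ne')
  refine ⟨(hV.mul hQ).smul (Units.mk0 _ hc), ?_, ?_⟩
  · rw [nonsing_inv_nonsing_inv _ ((isUnit_iff_isUnit_det _).mp hPu), hSK,
      inv_mul_gram_mul_eq hVK hQ ((commute_diagonal _ _).pow_left 2) hc]
    rw [diagonal_pow, diagonal_pow, ← diagonal_smul]
    congr 1
    ext i
    simp [mul_pow, Real.sq_sqrt hβ.le]
  · have c2 (X : Matrix (Fin n) (Fin n) ℝ) : Uᵀ * φ * (φ⁻¹ * U * X) = X := by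
      rw [← Matrix.mul_assoc, hKV, Matrix.one_mul]
    rw [hHK]
    generalize φ⁻¹ * U = V at *
    generalize Uᵀ * φ = K at *
    have hT (X : Matrix (Fin n) (Fin n) ℝ) : Vᵀ * (Kᵀ * X) = X := by
      rw [← Matrix.mul_assoc, ← transpose_mul, hKV, transpose_one, Matrix.one_mul]
    simp only [transpose_smul, transpose_mul, diagonal_transpose, Matrix.smul_mul,
      Matrix.mul_smul, Matrix.mul_assoc, c2, hT, smul_smul, hcc, diagonal_mul_diagonal,
      ← diagonal_smul]
    congr 1
    ext i
    simp only [Pi.smul_apply, smul_eq_mul]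
    linear_combination √β * d i * Real.mul_self_sqrt (he i).le
end
end

section
/- Let L, M, N ∈ ℝ^{n×n} be symmetric with M positive definite. Then there exists an invertible matrix W ∈ ℝ^{n×n} such that WᵀLW, WᵀMW, and WᵀNW are all diagonal if and only if LM^{−1}N = NM^{−1}L. (Simultaneous diagonalization criterion for three symmetric matrices, Theorem 3 in the paper, used to solve the structure-preserving balancing problem for port-Hamiltonian systems.) -/
open Matrix

noncomputable section

/-- Commuting symmetric operators on a finite-dimensional inner product space have a common
orthonormal basis of eigenvectors. -/
theorem LinearMap.IsSymmetric.exists_orthonormalBasis_of_commute {𝕜 E ι : Type*} [RCLike 𝕜]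
    [NormedAddCommGroup E] [InnerProductSpace 𝕜 E] [FiniteDimensional 𝕜 E] [Fintype ι]
    (hι : Module.finrank 𝕜 E = Fintype.card ι) {A B : E →ₗ[𝕜] E}
    (hA : A.IsSymmetric) (hB : B.IsSymmetric) (hAB : Commute A B) :
    ∃ (b : OrthonormalBasis ι 𝕜 E) (α β : ι → 𝕜),
      (∀ i, A (b i) = α i • b i) ∧ ∀ i, B (b i) = β i • b i := by
  classical
  have hint := directSum_isInternal_of_commute hA hB hAB
  have hfam := orthogonalFamily_eigenspace_inf_eigenspace hA hB
  let v (i : 𝕜 × 𝕜) := stdOrthonormalBasis 𝕜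
    (Module.End.eigenspace A i.2 ⊓ Module.End.eigenspace B i.1 : Submodule 𝕜 E)
  let c := hint.collectedBasis fun i => (v i).toBasis
  have hc : Orthonormal 𝕜 c :=
    hint.collectedBasis_orthonormal hfam fun i => by simp
  have hmem := hint.collectedBasis_mem fun i => (v i).toBasis
  have := Module.Finite.finite_basis c
  have := Fintype.ofFinite
    (Σ i : 𝕜 × 𝕜, Fin (Module.finrank 𝕜
      (Module.End.eigenspace A i.2 ⊓ Module.End.eigenspace B i.1 : Submodule 𝕜 E)))
  let e := Fintype.equivOfCardEq ((Module.finrank_eq_card_basis c).symm.trans hι)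
  refine ⟨(c.toOrthonormalBasis hc).reindex e, fun i => (e.symm i).1.2, fun i => (e.symm i).1.1,
    fun i => ?_, fun i => ?_⟩
  · simpa only [OrthonormalBasis.reindex_apply, Module.Basis.coe_toOrthonormalBasis] using
      Module.End.mem_eigenspace_iff.mp (hmem (e.symm i)).1
  · simpa only [OrthonormalBasis.reindex_apply, Module.Basis.coe_toOrthonormalBasis] using
      Module.End.mem_eigenspace_iff.mp (hmem (e.symm i)).2

namespace Matrix

variable {ι : Type*} [Fintype ι] [DecidableEq ι]

/-- Commuting real symmetric matrices are simultaneously orthogonally diagonalizable. -/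
theorem IsSymm.exists_orthogonal_isDiag_of_commute {A B : Matrix ι ι ℝ} (hA : A.IsSymm)
    (hB : B.IsSymm) (hAB : Commute A B) :
    ∃ U : Matrix ι ι ℝ, Uᵀ * U = 1 ∧ (Uᵀ * A * U).IsDiag ∧ (Uᵀ * B * U).IsDiag := by
  obtain ⟨b, α, β, hα, hβ⟩ :=
    (isSymmetric_toEuclideanLin_iff.mpr
        (isHermitian_iff_isSymm.mpr hA)).exists_orthonormalBasis_of_commute
      (ι := ι) finrank_euclideanSpace (isSymmetric_toEuclideanLin_iff.mpr
        (isHermitian_iff_isSymm.mpr hB))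
      (hAB.map (toLpLinAlgEquiv (R := ℝ) (n := ι) 2))
  let U : Matrix ι ι ℝ := of fun i j => b j i
  have hU : Uᵀ * U = 1 := by
    ext i j
    have := orthonormal_iff_ite.mp b.orthonormal j i
    simp only [PiLp.inner_apply, RCLike.inner_apply, conj_trivial] at this
    simp [U, mul_apply, this, one_apply, eq_comm]
  have key {C : Matrix ι ι ℝ} {γ : ι → ℝ} (hγ : ∀ i, toEuclideanLin C (b i) = γ i • b i) :
      (Uᵀ * C * U).IsDiag := by
    have hC : C * U = U * diagonal γ := by
      ext i j
      have := congrArg (fun x : EuclideanSpace ℝ ι => x i) (hγ j)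
      rw [mul_diagonal]
      simpa [U, mul_apply, toLpLin_apply, mulVec, dotProduct, mul_comm] using this
    rw [Matrix.mul_assoc, hC, ← Matrix.mul_assoc, hU, Matrix.one_mul]
    exact isDiag_diagonal γ
  exact ⟨U, hU, key hα, key hβ⟩

open scoped MatrixOrder Matrix.Norms.L2Operator in
/-- A positive definite real matrix is congruent to the identity. -/
theorem PosDef.exists_isUnit_transpose_mul_mul_eq_one {M : Matrix ι ι ℝ} (hM : M.PosDef) :
    ∃ V : Matrix ι ι ℝ, IsUnit V ∧ Vᵀ * M * V = 1 := by
  obtain ⟨B, rfl⟩ := CStarAlgebra.nonneg_iff_eq_star_mul_self.mp hM.posSemidef.nonneg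
  have hB : IsUnit B := isUnit_of_mul_isUnit_right hM.isUnit
  have hdet := (isUnit_iff_isUnit_det B).mp hB
  refine ⟨B⁻¹, (isUnit_nonsing_inv_iff).mpr hB, ?_⟩
  rw [star_eq_conjTranspose, conjTranspose_eq_transpose_of_trivial, ← Matrix.mul_assoc,
    ← transpose_mul, mul_nonsing_inv B hdet, transpose_one, Matrix.one_mul,
    mul_nonsing_inv B hdet]

theorem IsDiag.commute {R : Type*} [CommSemiring R] {A B : Matrix ι ι R} (hA : A.IsDiag)
    (hB : B.IsDiag) : Commute A B := by
  rw [← hA.diagonal_diag, ← hB.diagonal_diag]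
  exact commute_diagonal _ _

theorem IsDiag.inv {R : Type*} [CommRing R] {A : Matrix ι ι R} (hA : A.IsDiag) :
    A⁻¹.IsDiag := by
  rw [← hA.diagonal_diag, inv_diagonal]
  exact isDiag_diagonal _

theorem IsDiag.mul {R : Type*} [Semiring R] {A B : Matrix ι ι R} (hA : A.IsDiag)
    (hB : B.IsDiag) : (A * B).IsDiag := by
  rw [← hA.diagonal_diag, ← hB.diagonal_diag, diagonal_mul_diagonal]
  exact isDiag_diagonal _

/-- Under a congruence by an invertible `W`, the product `L * M⁻¹ * N` transforms like a
bilinear form. -/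
theorem congruence_mul_inv_mul {R : Type*} [CommRing R] {W : Matrix ι ι R} (hW : IsUnit W)
    (L M N : Matrix ι ι R) :
    (Wᵀ * L * W) * (Wᵀ * M * W)⁻¹ * (Wᵀ * N * W) = Wᵀ * (L * M⁻¹ * N) * W := by
  have hdet := (isUnit_iff_isUnit_det W).mp hW
  have hdet' : IsUnit Wᵀ.det := by rwa [det_transpose]
  simp only [Matrix.mul_inv_rev, Matrix.mul_assoc]
  rw [mul_nonsing_inv_cancel_left _ _ hdet, nonsing_inv_mul_cancel_left _ _ hdet']

theorem congruence_injective {R : Type*} [CommRing R] {W : Matrix ι ι R} (hW : IsUnit W) :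
    Function.Injective fun A : Matrix ι ι R => Wᵀ * A * W := by
  intro A B h
  exact ((isUnit_transpose W).mpr hW).mul_left_cancel (hW.mul_right_cancel h)

end Matrix

/-- Theorem 3 in the paper: for symmetric `L, M, N` with `M` positive
definite, there is an invertible congruence transformation `W` diagonalizing `L`, `M`
and `N` simultaneously if and only if `LM⁻¹N = NM⁻¹L`. -/
theorem simultaneous_diagonalization_iff {n : ℕ}
    (L M N : Matrix (Fin n) (Fin n) ℝ)
    (hL : Lᵀ = L) (hM : M.PosDef) (hN : Nᵀ = N) :
    (∃ W : Matrix (Fin n) (Fin n) ℝ, IsUnit W ∧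
      (Wᵀ * L * W).IsDiag ∧ (Wᵀ * M * W).IsDiag ∧ (Wᵀ * N * W).IsDiag) ↔
    L * M⁻¹ * N = N * M⁻¹ * L := by
  constructor
  · rintro ⟨W, hW, hDL, hDM, hDN⟩
    apply congruence_injective hW
    simp only [← congruence_mul_inv_mul hW]
    rw [((hDL.mul hDM.inv).commute hDN).eq, (hDL.commute hDM.inv).eq, ← Matrix.mul_assoc]
  · intro h
    obtain ⟨V, hV, hVM⟩ := hM.exists_isUnit_transpose_mul_mul_eq_one
    have hcomm : Commute (Vᵀ * L * V) (Vᵀ * N * V) := by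
      have hLN := congruence_mul_inv_mul hV L M N
      have hNL := congruence_mul_inv_mul hV N M L
      rw [hVM, inv_one, Matrix.mul_one] at hLN hNL
      exact hLN.trans ((congrArg (fun A => Vᵀ * A * V) h).trans hNL.symm)
    have hsymm {A : Matrix (Fin n) (Fin n) ℝ} (hA : Aᵀ = A) : (Vᵀ * A * V).IsSymm := by
      simp [IsSymm, transpose_mul, hA, Matrix.mul_assoc]
    obtain ⟨U, hU, hUL, hUN⟩ :=
      (hsymm hL).exists_orthogonal_isDiag_of_commute (hsymm hN) hcomm
    have hassoc (A : Matrix (Fin n) (Fin n) ℝ) :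
        (V * U)ᵀ * A * (V * U) = Uᵀ * (Vᵀ * A * V) * U := by
      simp only [transpose_mul, Matrix.mul_assoc]
    refine ⟨V * U, hV.mul (IsUnit.of_mul_eq_one_right _ hU), ?_, ?_, ?_⟩
    · rwa [hassoc]
    · rw [hassoc, hVM, Matrix.mul_one, hU]
      exact isDiag_one
    · rwa [hassoc]
end
end
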